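/- For every graph sequence 𝒢 and every field K, β_K(𝒢) ≤ c(𝒢) − 1. -/

import Mathlib

open Filter Function Set
open scoped Classical TensorProduct Pointwise symmDiff

universe u

namespace GraphSeqPaper

/-- The space of `K`-valued antisymmetric functions supported on the (oriented) edges of `G`:
the `K`-vector space spanned by the edges with the convention `(x,y) = -(y,x)`. -/
def edgeSpace (K : Type*) [Field K] {V : Type u} (G : SimpleGraph V) :
    Submodule K (V → V → K) where
  carrier := {f | (∀ x y, ¬ G.Adj x y → f x y = 0) ∧ ∀ x y, f x y = - f y x}
  add_mem' := by
    rintro f g ⟨hf1, hf2⟩ ⟨hg1, hg2⟩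
    refine ⟨fun x y h => ?_, fun x y => ?_⟩
    · simp only [Pi.add_apply, hf1 x y h, hg1 x y h, add_zero]
    · simp only [Pi.add_apply, hf2 x y, hg2 x y]; ring
  zero_mem' := ⟨fun x y _ => rfl, fun x y => by simp⟩
  smul_mem' := by
    rintro c f ⟨hf1, hf2⟩
    refine ⟨fun x y h => ?_, fun x y => ?_⟩
    · simp only [Pi.smul_apply, hf1 x y h, smul_zero]
    · simp only [Pi.smul_apply, hf2 x y, smul_neg]

lemma edgeSpace_mono (K : Type*) [Field K] {V : Type u} {H G : SimpleGraph V}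
    (h : H ≤ G) : edgeSpace K H ≤ edgeSpace K G :=
  fun f hf => ⟨fun x y hxy => hf.1 x y fun ha => hxy (h ha), hf.2⟩

/-- The basis vector of `ε_K` associated to the oriented edge `(x,y)`. -/
noncomputable def edgeVec (K : Type*) [Field K] {V : Type u} (x y : V) : V → V → K :=
  fun a b => if a = x ∧ b = y then (1 : K) else if a = y ∧ b = x then (-1 : K) else 0

/-- The vector of a walk `(x₀, x₁, …, x_l)`, namely `Σ_{i} (x_i, x_{i+1})`. -/
noncomputable def walkVec (K : Type*) [Field K] {V : Type u} {G : SimpleGraph V} :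
    ∀ {x y : V}, G.Walk x y → (V → V → K)
  | _, _, SimpleGraph.Walk.nil => 0
  | _, _, @SimpleGraph.Walk.cons _ _ a b _ _ p => edgeVec K a b + walkVec K p

/-- `C^q_K(G)`: the subspace of `ε_K(G)` spanned by the vectors of cycles of length at most
`q`. -/
noncomputable def cycleSpace (K : Type*) [Field K] {V : Type u} (G : SimpleGraph V) (q : ℕ) :
    Submodule K (V → V → K) :=
  Submodule.span K
    {f | ∃ (x : V) (c : G.Walk x x), c.IsCycle ∧ c.length ≤ q ∧ f = walkVec K c}

/-- A graph sequence: finite simple graphs, of uniformly bounded vertex degrees, whose number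
of vertices tends to infinity. -/
def IsGraphSeq (V : ℕ → Type u) (G : ∀ n, SimpleGraph (V n)) : Prop :=
  (∀ n, Finite (V n)) ∧
    (∃ D : ℕ, ∀ n (x : V n), ((G n).neighborSet x).ncard ≤ D) ∧
      Tendsto (fun n => Nat.card (V n)) atTop atTop

/-- `ℋ ≺ 𝒢`: there is an integer `L > 0` with `d_{G_n}(x,y) ≤ L · d_{H_n}(x,y)` for all `n`
and all vertices `x, y`. -/
def Prec {V : ℕ → Type u} (H G : ∀ n, SimpleGraph (V n)) : Prop :=
  ∃ L : ℕ, 0 < L ∧ ∀ n (x y : V n), (G n).dist x y ≤ L * (H n).dist x y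

/-- `𝒢 ≃ ℋ`: `ℋ ≺ 𝒢` and `𝒢 ≺ ℋ`. -/
def GEquiv {V : ℕ → Type u} (G H : ∀ n, SimpleGraph (V n)) : Prop :=
  Prec H G ∧ Prec G H

/-- The edge number `e(𝒢) = liminf |E(G_n)|/|V(G_n)|`. -/
noncomputable def edgeNum {V : ℕ → Type u} (G : ∀ n, SimpleGraph (V n)) : ℝ :=
  liminf (fun n => ((G n).edgeSet.ncard : ℝ) / (Nat.card (V n) : ℝ)) atTop

/-- The cost `c(𝒢) = inf { e(ℋ) : ℋ ≃ 𝒢 }`. -/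
noncomputable def cost {V : ℕ → Type u} (G : ∀ n, SimpleGraph (V n)) : ℝ :=
  sInf {r : ℝ | ∃ H : ∀ n, SimpleGraph (V n), IsGraphSeq V H ∧ GEquiv G H ∧ r = edgeNum H}

/-- `s^q_K(𝒢) = liminf (|E(G_n)| - dim_K C^q_K(G_n))/|V(G_n)| - 1`. -/
noncomputable def sInv (K : Type*) [Field K] {V : ℕ → Type u}
    (G : ∀ n, SimpleGraph (V n)) (q : ℕ) : ℝ :=
  liminf (fun n =>
    (((G n).edgeSet.ncard : ℝ) - (Module.finrank K (cycleSpace K (G n) q) : ℝ)) /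
      (Nat.card (V n) : ℝ)) atTop - 1

/-- `β_K(𝒢) = inf_q s^q_K(𝒢)`. -/
noncomputable def beta (K : Type*) [Field K] {V : ℕ → Type u}
    (G : ∀ n, SimpleGraph (V n)) : ℝ :=
  ⨅ q : ℕ, sInv K G q

/-- A large girth sequence: for every `k ≥ 1`, all but finitely many `G_n` contain no cycle of
length at most `k`. -/
def LargeGirth {V : ℕ → Type u} (G : ∀ n, SimpleGraph (V n)) : Prop :=
  ∀ k : ℕ, 1 ≤ k → ∃ N : ℕ, ∀ n, N ≤ n →
    ∀ (x : V n) (c : (G n).Walk x x), c.IsCycle → k < c.length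

/-- The set of edges of `G` whose two endpoints lie in different classes of the partition given
by the fibres of `P`. -/
def crossEdges {V : Type u} (G : SimpleGraph V) (P : V → ℕ) : Set (Sym2 V) :=
  {e | e ∈ G.edgeSet ∧ ∃ x ∈ e, ∃ y ∈ e, P x ≠ P y}

/-- Hyperfiniteness of a graph sequence. -/
def Hyperfinite {V : ℕ → Type u} (G : ∀ n, SimpleGraph (V n)) : Prop :=
  ∀ ε : ℝ, 0 < ε → ∃ Kb : ℕ, ∃ P : ∀ n, V n → ℕ,
    (∀ n i, {x : V n | P n x = i}.ncard ≤ Kb) ∧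
      liminf (fun n => ((crossEdges (G n) (P n)).ncard : ℝ) / (Nat.card (V n) : ℝ)) atTop ≤ ε

/-- The Cayley graph of a group with respect to a (symmetric) set `T`:
`x ~ y` iff `x ≠ y` and `y x⁻¹ ∈ T` (or `x y⁻¹ ∈ T`). -/
def cayley (Q : Type u) [Group Q] (T : Set Q) : SimpleGraph Q :=
  SimpleGraph.fromRel (fun x y => y * x⁻¹ ∈ T)

/-- The Cayley graph of the quotient `Γ ⧸ N` with respect to the image of `S`. -/
def cayleyQuot {Γ : Type u} [Group Γ] (N : Subgroup Γ) (hN : N.Normal) (S : Set Γ) :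
    SimpleGraph (Γ ⧸ N) :=
  haveI := hN
  cayley (Γ ⧸ N) ((fun g => (QuotientGroup.mk g : Γ ⧸ N)) '' S)

/-- The minimal number of generators of a group. -/
noncomputable def minGens (Λ : Type u) [Group Λ] : ℕ :=
  sInf {d : ℕ | ∃ T : Set Λ, T.Finite ∧ T.ncard = d ∧ Subgroup.closure T = ⊤}

/-- A group is finitely presented. -/
def FinitelyPresentedGroup (Γ : Type u) [Group Γ] : Prop :=
  ∃ (n : ℕ) (f : FreeGroup (Fin n) →* Γ) (R : Set (FreeGroup (Fin n))),
    Surjective f ∧ R.Finite ∧ f.ker = Subgroup.normalClosure R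

/-- Amenability via the Følner condition. -/
def IsAmenableFolner (Γ : Type u) [Group Γ] : Prop :=
  ∀ F : Set Γ, F.Finite → ∀ ε : ℝ, 0 < ε →
    ∃ A : Set Γ, A.Finite ∧ A.Nonempty ∧
      ∀ s ∈ F, (((s • A) ∆ A).ncard : ℝ) ≤ ε * A.ncard

/-- The set of edges of `G` joining `F` to its complement. -/
def edgeBoundary {V : Type u} (G : SimpleGraph V) (F : Set V) : Set (Sym2 V) :=
  {e | e ∈ G.edgeSet ∧ ∃ x ∈ e, ∃ y ∈ e, x ∈ F ∧ y ∉ F}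

section WalkVec

variable (K : Type*) [Field K] {V : Type u} {G H : SimpleGraph V}

lemma edgeVec_swap {x y : V} (h : x ≠ y) : edgeVec K y x = -edgeVec K x y := by
  funext a b
  simp only [edgeVec, Pi.neg_apply]
  by_cases h1 : a = x ∧ b = y
  · obtain ⟨rfl, rfl⟩ := h1
    simp [h]
  · by_cases h2 : a = y ∧ b = x
    · obtain ⟨rfl, rfl⟩ := h2
      simp [h.symm]
    · simp [h1, h2]

@[simp]
lemma walkVec_nil {x : V} : walkVec K (SimpleGraph.Walk.nil : G.Walk x x) = 0 := rfl

@[simp]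
lemma walkVec_cons {x y z : V} (h : G.Adj x y) (p : G.Walk y z) :
    walkVec K (SimpleGraph.Walk.cons h p) = edgeVec K x y + walkVec K p := rfl

lemma walkVec_append {x y z : V} (p : G.Walk x y) (r : G.Walk y z) :
    walkVec K (p.append r) = walkVec K p + walkVec K r := by
  induction p with
  | nil => simp
  | cons h p ih => simp [ih, add_assoc]

lemma walkVec_reverse {x y : V} (p : G.Walk x y) :
    walkVec K p.reverse = -walkVec K p := by
  induction p with
  | nil => simp
  | cons h p ih =>
    simp [walkVec_append, ih, edgeVec_swap K h.ne]

/-- Closing up a path by an edge gives an element of the cycle space. -/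
lemma edgeVec_add_walkVec_mem_cycleSpace {q : ℕ} {u v : V} (h : G.Adj u v) (p : G.Walk v u)
    (hp : p.IsPath) (hl : p.length + 1 ≤ q) :
    edgeVec K u v + walkVec K p ∈ cycleSpace K G q := by
  by_cases he : s(u, v) ∈ p.edges
  · cases p with
    | nil => exact absurd rfl h.ne
    | @cons _ w _ h' p' =>
      rw [SimpleGraph.Walk.cons_isPath_iff] at hp
      rw [SimpleGraph.Walk.edges_cons, List.mem_cons] at he
      rcases he with he | he
      · have hw : u = w := by
          have := h.ne
          simp only [Sym2.eq_iff] at he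
          grind
        subst hw
        obtain rfl := (SimpleGraph.Walk.isPath_iff_nil.1 hp.1).eq_nil
        simp [edgeVec_swap K h.ne]
      · exact absurd (p'.snd_mem_support_of_mem_edges he) hp.2
  · refine Submodule.subset_span ⟨u, SimpleGraph.Walk.cons h p, ?_, by simpa using hl, rfl⟩
    exact (SimpleGraph.Walk.cons_isCycle_iff p h).2 ⟨hp, he⟩

lemma walkVec_sub_walkVec_bypass_mem_cycleSpace {q : ℕ} {u v : V} (p : G.Walk u v)
    (hl : p.length ≤ q) : walkVec K p - walkVec K p.bypass ∈ cycleSpace K G q := by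
  induction p with
  | nil => simp [SimpleGraph.Walk.bypass]
  | @cons u v w h p ih =>
    rw [SimpleGraph.Walk.length_cons] at hl
    have ih := ih (by omega)
    by_cases hs : u ∈ p.bypass.support
    · have hb : (SimpleGraph.Walk.cons h p).bypass = p.bypass.dropUntil u hs := by
        simp [SimpleGraph.Walk.bypass, hs]
      have hsplit := walkVec_append K (p.bypass.takeUntil u hs) (p.bypass.dropUntil u hs)
      rw [SimpleGraph.Walk.take_spec] at hsplit
      have hlen : (p.bypass.takeUntil u hs).length + 1 ≤ q := by
        have h1 := p.bypass.length_takeUntil_le_length hs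
        have h2 := p.length_bypass_le_length
        omega
      have hc := edgeVec_add_walkVec_mem_cycleSpace K h (p.bypass.takeUntil u hs)
        (p.bypass_isPath.takeUntil hs) hlen
      rw [hb, walkVec_cons]
      convert add_mem ih hc using 1
      rw [hsplit]
      abel
    · have hb : (SimpleGraph.Walk.cons h p).bypass = SimpleGraph.Walk.cons h p.bypass := by
        simp [SimpleGraph.Walk.bypass, hs]
      rw [hb, walkVec_cons, walkVec_cons, add_sub_add_left_eq_sub]
      exact ih

/-- An edge agrees, modulo short cycles, with any short walk joining its endpoints. -/
lemma edgeVec_sub_walkVec_mem_cycleSpace {q : ℕ} {u v : V} (h : G.Adj u v) (p : G.Walk u v)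
    (hl : p.length + 1 ≤ q) : edgeVec K u v - walkVec K p ∈ cycleSpace K G q := by
  have h1 := walkVec_sub_walkVec_bypass_mem_cycleSpace K (q := q) p.reverse
    (by rw [SimpleGraph.Walk.length_reverse]; omega)
  have h2 := edgeVec_add_walkVec_mem_cycleSpace K (q := q) h p.reverse.bypass
    p.reverse.bypass_isPath (by
      have := p.reverse.length_bypass_le_length
      rw [SimpleGraph.Walk.length_reverse] at this
      omega)
  convert add_mem h1 h2 using 1
  rw [walkVec_reverse]
  abel

/-- The edge vectors of `G`, one for each unoriented edge. -/
noncomputable def orientedEdgeVec (G : SimpleGraph V) (e : G.edgeSet) : V → V → K :=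
  edgeVec K (Quot.out e.1).1 (Quot.out e.1).2

lemma mk_out (e : Sym2 V) : s((Quot.out e).1, (Quot.out e).2) = e := Quot.out_eq e

lemma linearIndependent_orientedEdgeVec (G : SimpleGraph V) :
    LinearIndependent K (orientedEdgeVec K G) := by
  rw [linearIndependent_iff']
  intro s g hg e he
  have h := congrFun (congrFun hg (Quot.out e.1).1) (Quot.out e.1).2
  simp only [Finset.sum_apply, Pi.smul_apply, smul_eq_mul, Pi.zero_apply] at h
  rw [Finset.sum_eq_single_of_mem e he] at h
  · simpa [orientedEdgeVec, edgeVec] using h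
  · intro e' _ hne
    have hne' : s((Quot.out e'.1).1, (Quot.out e'.1).2) ≠
        s((Quot.out e.1).1, (Quot.out e.1).2) := by
      rw [mk_out, mk_out]
      exact fun hh => hne (Subtype.ext hh)
    rw [Ne, Sym2.eq_iff] at hne'
    have h1 : orientedEdgeVec K G e' (Quot.out e.1).1 (Quot.out e.1).2 = 0 := by
      simp only [orientedEdgeVec, edgeVec]
      rw [if_neg (by grind), if_neg (by grind)]
    rw [h1, mul_zero]

lemma finrank_span_orientedEdgeVec [Finite V] (G : SimpleGraph V) :
    Module.finrank K (Submodule.span K (Set.range (orientedEdgeVec K G))) = G.edgeSet.ncard := by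
  have := Fintype.ofFinite V
  rw [finrank_span_eq_card (linearIndependent_orientedEdgeVec K G), ← Nat.card_eq_fintype_card]
  rfl

lemma edgeVec_mem_span {x y : V} (h : G.Adj x y) :
    edgeVec K x y ∈ Submodule.span K (Set.range (orientedEdgeVec K G)) := by
  have hm : orientedEdgeVec K G ⟨s(x, y), h⟩ ∈
      Submodule.span K (Set.range (orientedEdgeVec K G)) :=
    Submodule.subset_span ⟨_, rfl⟩
  have ho := mk_out s(x, y)
  rw [Sym2.eq_iff] at ho
  rcases ho with ⟨h1, h2⟩ | ⟨h1, h2⟩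
  · simpa only [orientedEdgeVec, h1, h2] using hm
  · simp only [orientedEdgeVec, h1, h2] at hm
    rw [edgeVec_swap K h.ne] at hm
    exact neg_mem_iff.1 hm

lemma walkVec_mem_span {x y : V} (p : G.Walk x y) :
    walkVec K p ∈ Submodule.span K (Set.range (orientedEdgeVec K G)) := by
  induction p with
  | nil => exact zero_mem _
  | cons h p ih => exact add_mem (edgeVec_mem_span K h) ih

lemma finrank_cycleSpace_le [Finite V] (G : SimpleGraph V) (q : ℕ) :
    Module.finrank K (cycleSpace K G q) ≤ G.edgeSet.ncard := by
  have := Fintype.ofFinite V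
  rw [← finrank_span_orientedEdgeVec K G]
  refine Submodule.finrank_mono (Submodule.span_le.2 ?_)
  rintro _ ⟨x, c, -, -, rfl⟩
  exact walkVec_mem_span K c

/-- If every edge of `H` is replaced by a walk of length at most `L` in `G`, then every walk of `H`
can be replaced by a walk of `G` whose vector lies in the span of the replacement walks. -/
lemma exists_walk_of_replacement {L : ℕ}
    (P : ∀ e : H.edgeSet, G.Walk (Quot.out e.1).1 (Quot.out e.1).2)
    (hP : ∀ e, (P e).length ≤ L) {x y : V} (w : H.Walk x y) :
    ∃ p : G.Walk x y, p.length ≤ L * w.length ∧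
      walkVec K p ∈ Submodule.span K (Set.range fun e => walkVec K (P e)) := by
  induction w with
  | nil => exact ⟨.nil, by simp, zero_mem _⟩
  | @cons u v w h p ih =>
    obtain ⟨r, hr, hrm⟩ := ih
    obtain ⟨t, ht, htm⟩ : ∃ t : G.Walk u v, t.length ≤ L ∧
        walkVec K t ∈ Submodule.span K (Set.range fun e => walkVec K (P e)) := by
      have hm : walkVec K (P ⟨s(u, v), h⟩) ∈
          Submodule.span K (Set.range fun e => walkVec K (P e)) :=
        Submodule.subset_span ⟨_, rfl⟩
      have hl := hP ⟨s(u, v), h⟩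
      have ho := mk_out s(u, v)
      rw [Sym2.eq_iff] at ho
      generalize P ⟨s(u, v), h⟩ = t at hm hl
      generalize Quot.out s(u, v) = o at ho t
      obtain ⟨a, b⟩ := o
      rcases ho with ⟨rfl, rfl⟩ | ⟨rfl, rfl⟩
      · exact ⟨t, hl, hm⟩
      · refine ⟨t.reverse, by rwa [SimpleGraph.Walk.length_reverse], ?_⟩
        rw [walkVec_reverse]
        exact neg_mem hm
    refine ⟨t.append r, ?_, ?_⟩
    · rw [SimpleGraph.Walk.length_append, SimpleGraph.Walk.length_cons]
      linarith
    · rw [walkVec_append]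
      exact add_mem htm hrm

lemma exists_walk_length_le_of_dist_le {L M : ℕ} (h₁ : ∀ x y, G.dist x y ≤ L * H.dist x y)
    (h₂ : ∀ x y, H.dist x y ≤ M * G.dist x y) {x y : V} (h : H.Adj x y) :
    ∃ p : G.Walk x y, p.length ≤ L := by
  have hH := SimpleGraph.dist_eq_one_iff_adj.2 h
  have hr : G.Reachable x y := by
    by_contra hn
    have := h₂ x y
    rw [SimpleGraph.dist_eq_zero_of_not_reachable hn] at this
    omega
  obtain ⟨p, hp⟩ := hr.exists_walk_length_eq_dist
  have := h₁ x y
  rw [hH, mul_one] at this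
  exact ⟨p, by omega⟩

/-- If the metrics of `G` and `H` are Lipschitz equivalent, the edges of `G` modulo short cycles
are spanned by the images of the edges of `H`. -/
lemma ncard_edgeSet_le_of_dist_le [Finite V] {L M : ℕ}
    (h₁ : ∀ x y, G.dist x y ≤ L * H.dist x y) (h₂ : ∀ x y, H.dist x y ≤ M * G.dist x y) :
    G.edgeSet.ncard ≤
      Module.finrank K (cycleSpace K G (L * M + 1)) + H.edgeSet.ncard := by
  have := Fintype.ofFinite V
  have hex : ∀ e : H.edgeSet, ∃ p : G.Walk (Quot.out e.1).1 (Quot.out e.1).2, p.length ≤ L := by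
    intro e
    refine exists_walk_length_le_of_dist_le h₁ h₂ ?_
    rw [← SimpleGraph.mem_edgeSet, mk_out]
    exact e.2
  choose P hP using hex
  set S := Submodule.span K (Set.range fun e => walkVec K (P e))
  have hS : Module.finrank K S ≤ H.edgeSet.ncard := by
    refine (finrank_range_le_card _).trans_eq ?_
    rw [← Nat.card_eq_fintype_card]
    rfl
  have hle : Submodule.span K (Set.range (orientedEdgeVec K G)) ≤
      cycleSpace K G (L * M + 1) ⊔ S := by
    refine Submodule.span_le.2 ?_
    rintro _ ⟨e, rfl⟩
    have hadj : G.Adj (Quot.out e.1).1 (Quot.out e.1).2 := by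
      rw [← SimpleGraph.mem_edgeSet, mk_out]
      exact e.2
    obtain ⟨w, hw⟩ := exists_walk_length_le_of_dist_le h₂ h₁ hadj
    obtain ⟨p, hp, hpm⟩ := exists_walk_of_replacement K P hP w
    have hlen : p.length + 1 ≤ L * M + 1 :=
      Nat.succ_le_succ (hp.trans (Nat.mul_le_mul_left L hw))
    exact Submodule.mem_sup.2
      ⟨_, edgeVec_sub_walkVec_mem_cycleSpace K hadj p hlen, _, hpm, sub_add_cancel _ _⟩
  rw [← finrank_span_orientedEdgeVec K G]
  exact (Submodule.finrank_mono hle).trans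
    ((Submodule.finrank_add_le_finrank_add_finrank _ _).trans (Nat.add_le_add_left hS _))

end WalkVec

lemma ncard_edgeSet_le_mul_card {V : Type u} [Finite V] (G : SimpleGraph V) {D : ℕ}
    (hD : ∀ x, (G.neighborSet x).ncard ≤ D) : G.edgeSet.ncard ≤ D * Nat.card V := by
  have := Fintype.ofFinite V
  have h := G.sum_degrees_eq_twice_card_edges
  have h1 : ∑ v, G.degree v ≤ ∑ _v : V, D := by
    refine Finset.sum_le_sum fun v _ => ?_
    rw [← SimpleGraph.card_neighborSet_eq_degree, ← Nat.card_eq_fintype_card]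
    exact hD v
  have h2 : G.edgeSet.ncard = G.edgeFinset.card := by
    rw [← SimpleGraph.coe_edgeFinset, Set.ncard_coe_finset]
  rw [Finset.sum_const, Finset.card_univ, smul_eq_mul, mul_comm] at h1
  rw [h2, Nat.card_eq_fintype_card]
  omega

lemma IsGraphSeq.exists_edge_density_le {V : ℕ → Type u} {G : ∀ n, SimpleGraph (V n)}
    (hG : IsGraphSeq V G) :
    ∃ D : ℝ, ∀ n, ((G n).edgeSet.ncard : ℝ) / (Nat.card (V n) : ℝ) ≤ D := by
  obtain ⟨hfin, ⟨D, hD⟩, -⟩ := hG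
  refine ⟨D, fun n => ?_⟩
  have := hfin n
  refine div_le_of_le_mul₀ (Nat.cast_nonneg _) (Nat.cast_nonneg _) ?_
  exact_mod_cast ncard_edgeSet_le_mul_card (G n) (hD n)

lemma cycle_defect_density_nonneg (K : Type*) [Field K] {V : Type u} [Finite V]
    (G : SimpleGraph V) (q : ℕ) :
    0 ≤ ((G.edgeSet.ncard : ℝ) - (Module.finrank K (cycleSpace K G q) : ℝ)) /
      (Nat.card V : ℝ) :=
  div_nonneg (sub_nonneg.2 (by exact_mod_cast finrank_cycleSpace_le K G q)) (Nat.cast_nonneg _)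

lemma neg_one_le_sInv (K : Type*) [Field K] {V : ℕ → Type u} {G : ∀ n, SimpleGraph (V n)}
    (hG : IsGraphSeq V G) (q : ℕ) : -1 ≤ sInv K G q := by
  obtain ⟨D, hD⟩ := hG.exists_edge_density_le
  have hbdd : IsBoundedUnder (· ≤ ·) atTop (fun n =>
      (((G n).edgeSet.ncard : ℝ) - (Module.finrank K (cycleSpace K (G n) q) : ℝ)) /
        (Nat.card (V n) : ℝ)) := by
    refine isBoundedUnder_of ⟨D, fun n => le_trans ?_ (hD n)⟩
    gcongr
    exact sub_le_self _ (Nat.cast_nonneg _)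
  have h := le_liminf_of_le hbdd.isCoboundedUnder_ge (Eventually.of_forall fun n =>
    have := hG.1 n
    cycle_defect_density_nonneg K (G n) q)
  unfold sInv
  linarith

lemma exists_sInv_le_edgeNum_sub_one (K : Type*) [Field K] {V : ℕ → Type u}
    {G H : ∀ n, SimpleGraph (V n)} (hH : IsGraphSeq V H) (h : GEquiv G H) :
    ∃ q, sInv K G q ≤ edgeNum H - 1 := by
  obtain ⟨⟨L, -, hL⟩, ⟨M, -, hM⟩⟩ := h
  refine ⟨L * M + 1, sub_le_sub_right ?_ 1⟩
  obtain ⟨D, hD⟩ := hH.exists_edge_density_le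
  refine liminf_le_liminf (Eventually.of_forall fun n => ?_)
    (isBoundedUnder_of ⟨0, fun n => ?_⟩)
    (isBoundedUnder_of ⟨D, hD⟩ : IsBoundedUnder (· ≤ ·) atTop _).isCoboundedUnder_ge
  · have := hH.1 n
    have := ncard_edgeSet_le_of_dist_le K (hL n) (hM n)
    gcongr
    rw [sub_le_iff_le_add']
    exact_mod_cast this
  · have := hH.1 n
    exact cycle_defect_density_nonneg K (G n) _

theorem beta_le_cost_sub_one (K : Type*) [Field K] {V : ℕ → Type u}
    (G : ∀ n, SimpleGraph (V n)) (hG : IsGraphSeq V G) :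
    beta K G ≤ cost G - 1 := by
  have hrefl : Prec G G := ⟨1, one_pos, fun n x y => by rw [one_mul]⟩
  rw [le_sub_iff_add_le]
  refine le_csInf ⟨_, G, hG, ⟨hrefl, hrefl⟩, rfl⟩ ?_
  rintro _ ⟨H, hH, hGH, rfl⟩
  obtain ⟨q, hq⟩ := exists_sInv_le_edgeNum_sub_one K hH hGH
  rw [← le_sub_iff_add_le]
  exact (ciInf_le ⟨-1, Set.forall_mem_range.2 (neg_one_le_sInv K hG)⟩ q).trans hq

end GraphSeqPaper
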